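/- arXiv:1907.01287 — 14 statements merged into one kernel-verified Lean document; each statement's English description precedes it below -/
import Mathlib

section
/- For every σ > 0, p ∈ ℝ, n > 0 and α > 0, one has sup_{η ∈ ℝ} [(n·p + α)·η − n·σ²·η²/2] − sup_{η ∈ ℝ} [n·p·η − n·σ²·η²/2] = (α/σ²)·(p + α/(2n)). In particular, for Gaussian rewards with common variance σ², the RBMLE index of an arm with empirical mean p and pull count n equals, up to the positive factor α/σ² independent of the arm, the quantity p + α/(2n). -/
lemma sSup_quadratic_aux (b c : ℝ) (hc : 0 < c) :
    sSup (Set.range fun η : ℝ => b * η - c * η ^ 2 / 2) = b ^ 2 / (2 * c) := by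
  have h : IsGreatest (Set.range fun η : ℝ => b * η - c * η ^ 2 / 2) (b ^ 2 / (2 * c)) := by
    constructor
    · refine ⟨b / c, ?_⟩
      field_simp
      ring
    · rintro _ ⟨η, rfl⟩
      show b * η - c * η ^ 2 / 2 ≤ b ^ 2 / (2 * c)
      rw [le_div_iff₀ (by positivity)]
      nlinarith [sq_nonneg (b - c * η)]
  exact h.csSup_eq

/-- The RBMLE index for Gaussian bandits with common variance `σ²`
equals `(α/σ²)·(p + α/(2n))`. -/
theorem rbmle_index_gaussian
    (σ p n α : ℝ) (hσ : 0 < σ) (hn : 0 < n) (hα : 0 < α) :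
    sSup (Set.range fun η : ℝ => (n * p + α) * η - n * σ ^ 2 * η ^ 2 / 2)
      - sSup (Set.range fun η : ℝ => n * p * η - n * σ ^ 2 * η ^ 2 / 2)
      = (α / σ ^ 2) * (p + α / (2 * n)) := by
  have hc : 0 < n * σ ^ 2 := by positivity
  rw [sSup_quadratic_aux (n * p + α) _ hc, sSup_quadratic_aux (n * p) _ hc]
  field_simp
  ring
end

section
/- Let O and S be open intervals of ℝ and let F : ℝ → ℝ be twice differentiable on O with derivative F' strictly increasing on O and mapping O bijectively onto S; let G : S → O be the inverse of F' on O. Fix ν ∈ S and α > 0. Then the RBMLE index I(ν, n, α) is strictly decreasing in n: for all n₁, n₂ with 0 < n₁ < n₂ and ν + α/n₁ ∈ S, one has I(ν, n₁, α) > I(ν, n₂, α). -/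
/-- Lemma 1(i): The RBMLE index `I(ν, n, α)` is strictly decreasing
in the pull count `n`. -/
theorem rbmle_index_strict_anti_in_n
    (O S : Set ℝ) (hO : IsOpen O) (hOc : O.OrdConnected)
    (hSo : IsOpen S) (hSc : S.OrdConnected)
    (F F' F'' : ℝ → ℝ)
    (hd1 : ∀ x ∈ O, HasDerivAt F (F' x) x)
    (hd2 : ∀ x ∈ O, HasDerivAt F' (F'' x) x)
    (hmono : StrictMonoOn F' O)
    (hbij : Set.BijOn F' O S)
    (G : ℝ → ℝ)
    (hGmaps : Set.MapsTo G S O)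
    (hGF : ∀ x ∈ S, F' (G x) = x)
    (hFG : ∀ η ∈ O, G (F' η) = η)
    (I : ℝ → ℝ → ℝ → ℝ)
    (hI : ∀ ν n α, I ν n α =
      (n * ν + α) * G (ν + α / n) - n * ν * G ν
        - n * F (G (ν + α / n)) + n * F (G ν))
    (ν α : ℝ) (hν : ν ∈ S) (hα : 0 < α) :
    ∀ n₁ n₂ : ℝ, 0 < n₁ → n₁ < n₂ → ν + α / n₁ ∈ S →
      I ν n₂ α < I ν n₁ α := by
  intro n₁ n₂ h1 h12 hS1
  have h2 : 0 < n₂ := h1.trans h12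
  have hlt : α / n₂ < α / n₁ := div_lt_div_of_pos_left hα h1 h12
  have hp2 : 0 < α / n₂ := div_pos hα h2
  have hS2 : ν + α / n₂ ∈ S := hSc.out hν hS1 ⟨by linarith, by linarith⟩
  have mvt : ∀ x ∈ O, ∀ y ∈ O, x < y → ∃ c ∈ Set.Ioo x y, c ∈ O ∧
      F y - F x = F' c * (y - x) := by
    intro x hx y hy hxy
    have hsub : Set.Icc x y ⊆ O := hOc.out hx hy
    obtain ⟨c, hc, h⟩ := exists_hasDerivAt_eq_slope F F' hxy
      (fun z hz => (hd1 z (hsub hz)).continuousAt.continuousWithinAt)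
      (fun z hz => hd1 z (hsub (Set.Ioo_subset_Icc_self hz)))
    refine ⟨c, hc, hsub (Set.Ioo_subset_Icc_self hc), ?_⟩
    have : y - x ≠ 0 := by linarith
    rw [h]
    field_simp
  have hGm : ∀ s ∈ S, ∀ t ∈ S, s < t → G s < G t := by
    intro s hs t ht hst
    rw [← hmono.lt_iff_lt (hGmaps hs) (hGmaps ht), hGF s hs, hGF t ht]
    exact hst
  have hgb := hGm _ hν _ hS2 (by linarith)
  have hba := hGm _ hS2 _ hS1 (by linarith)
  have ea := hGF _ hS1
  have eg := hGF _ hν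
  have hgO := hGmaps hν
  have hbO := hGmaps hS2
  have haO := hGmaps hS1
  have e1 : n₁ * (α / n₁) = α := by field_simp
  rw [hI, hI]
  generalize G (ν + α / n₁) = a at *
  generalize G (ν + α / n₂) = b at *
  generalize G ν = g at *
  obtain ⟨c, hc, hcO, hcF⟩ := mvt g hgO b hbO hgb
  obtain ⟨d, hd, hdO, hdF⟩ := mvt b hbO a haO hba
  have k1 : ν < F' c := by rw [← eg]; exact hmono hgO hcO hc.1
  have k2 : F' d < ν + α / n₁ := by rw [← ea]; exact hmono hdO haO hd.2
  have m1 : ν * (b - g) < F b - F g := by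
    rw [hcF]; exact mul_lt_mul_of_pos_right k1 (by linarith)
  have m2 : F a - F b < (ν + α / n₁) * (a - b) := by
    rw [hdF]; exact mul_lt_mul_of_pos_right k2 (by linarith)
  have p1 := mul_lt_mul_of_pos_left m1 (sub_pos.2 h12)
  have p2 := mul_lt_mul_of_pos_left m2 h1
  have p3 : n₁ * ((ν + α / n₁) * (a - b)) = (n₁ * ν + α) * (a - b) := by
    rw [← mul_assoc, mul_add, e1]
  rw [p3] at p2
  nlinarith
end

section
/- Let O and S be open intervals of ℝ and let F : ℝ → ℝ be twice differentiable on O with derivative F' strictly increasing on O and mapping O bijectively onto S; let G : S → O be the inverse of F' on O. Fix n > 0 and α > 0. Then the RBMLE index I(ν, n, α) is strictly increasing in ν: for all ν₁, ν₂ ∈ S with ν₁ < ν₂ and ν₂ + α/n ∈ S, one has I(ν₁, n, α) < I(ν₂, n, α). -/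
/-- Lemma 1(ii): The RBMLE index `I(ν, n, α)` is strictly increasing
in the empirical mean `ν`. -/
theorem rbmle_index_strict_mono_in_nu
    (O S : Set ℝ) (hO : IsOpen O) (hOc : O.OrdConnected)
    (hSo : IsOpen S) (hSc : S.OrdConnected)
    (F F' F'' : ℝ → ℝ)
    (hd1 : ∀ x ∈ O, HasDerivAt F (F' x) x)
    (hd2 : ∀ x ∈ O, HasDerivAt F' (F'' x) x)
    (hmono : StrictMonoOn F' O)
    (hbij : Set.BijOn F' O S)
    (G : ℝ → ℝ)
    (hGmaps : Set.MapsTo G S O)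
    (hGF : ∀ x ∈ S, F' (G x) = x)
    (hFG : ∀ η ∈ O, G (F' η) = η)
    (I : ℝ → ℝ → ℝ → ℝ)
    (hI : ∀ ν n α, I ν n α =
      (n * ν + α) * G (ν + α / n) - n * ν * G ν
        - n * F (G (ν + α / n)) + n * F (G ν))
    (n α : ℝ) (hn : 0 < n) (hα : 0 < α) :
    ∀ ν₁ ν₂ : ℝ, ν₁ ∈ S → ν₂ ∈ S → ν₁ < ν₂ → ν₂ + α / n ∈ S →
      I ν₁ n α < I ν₂ n α := by
  have tang : ∀ x ∈ O, ∀ y ∈ O, x ≠ y → F y + F' y * (x - y) < F x := by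
    intro x hx y hy hxy
    rcases lt_or_gt_of_ne hxy with h | h
    · have hs : Set.Icc x y ⊆ O := hOc.out hx hy
      obtain ⟨c, hc, he⟩ := exists_hasDerivAt_eq_slope F F' h
        (fun z hz => (hd1 z (hs hz)).continuousAt.continuousWithinAt)
        (fun z hz => hd1 z (hs ⟨hz.1.le, hz.2.le⟩))
      have hm := hmono (hs ⟨hc.1.le, hc.2.le⟩) hy hc.2
      rw [eq_div_iff (by linarith)] at he
      nlinarith
    · have hs : Set.Icc y x ⊆ O := hOc.out hy hx
      obtain ⟨c, hc, he⟩ := exists_hasDerivAt_eq_slope F F' h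
        (fun z hz => (hd1 z (hs hz)).continuousAt.continuousWithinAt)
        (fun z hz => hd1 z (hs ⟨hz.1.le, hz.2.le⟩))
      have hm := hmono hy (hs ⟨hc.1.le, hc.2.le⟩) hc.1
      rw [eq_div_iff (by linarith)] at he
      nlinarith
  obtain ⟨H, hH⟩ : ∃ H : ℝ → ℝ, ∀ s, H s = s * G s - F (G s) := ⟨_, fun _ => rfl⟩
  have sub : ∀ s ∈ S, ∀ t ∈ S, s ≠ t → H s + G s * (t - s) < H t := by
    intro s hs t ht hst
    have hne : G s ≠ G t := fun h => hst (by rw [← hGF s hs, ← hGF t ht, h])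
    have := tang (G s) (hGmaps hs) (G t) (hGmaps ht) hne
    rw [hGF t ht] at this
    rw [hH, hH]
    linarith
  have conv : ∀ a ∈ S, ∀ d ∈ S, ∀ b, a < b → b < d →
      (d - a) * H b < (d - b) * H a + (b - a) * H d := by
    intro a ha d hd b hab hbd
    have hb : b ∈ S := hSc.out ha hd ⟨hab.le, hbd.le⟩
    have h1 := mul_lt_mul_of_pos_left (sub b hb a ha hab.ne') (sub_pos.2 hbd)
    have h2 := mul_lt_mul_of_pos_left (sub b hb d hd hbd.ne) (sub_pos.2 hab)
    linarith
  intro ν₁ ν₂ h1 h2 h12 h2c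
  have hc : 0 < α / n := div_pos hα hn
  have hI' : ∀ ν, I ν n α = n * (H (ν + α / n) - H ν) := by
    intro ν
    have : α = n * (α / n) := by field_simp
    rw [hI, hH, hH]
    linear_combination G (ν + α / n) * this
  rw [hI', hI']
  apply mul_lt_mul_of_pos_left _ hn
  generalize α / n = c at *
  have k1 := conv ν₁ h1 (ν₂ + c) h2c (ν₁ + c) (by linarith) (by linarith)
  have k2 := conv ν₁ h1 (ν₂ + c) h2c ν₂ (by linarith) (by linarith)
  have k3 : (ν₂ + c - ν₁) * (H (ν₁ + c) - H ν₁) < (ν₂ + c - ν₁) * (H (ν₂ + c) - H ν₂) := by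
    linarith
  exact lt_of_mul_lt_mul_left k3 (by linarith)
end

section
/- Let O and S be open intervals of ℝ and let F : ℝ → ℝ be twice differentiable on O with derivative F' strictly increasing on O and mapping O bijectively onto S; let G : S → O be the inverse of F' on O. Fix ν ∈ S. Then ξ(k; ν) is strictly decreasing in k: for all k₁, k₂ with 0 < k₁ < k₂ and ν + 1/k₁ ∈ S, one has ξ(k₁; ν) > ξ(k₂; ν). -/
/-- The function `ξ(k; ν)` is strictly decreasing in `k`. -/
theorem rbmle_xi_strict_anti
    (O S : Set ℝ) (hO : IsOpen O) (hOc : O.OrdConnected)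
    (hSo : IsOpen S) (hSc : S.OrdConnected)
    (F F' F'' : ℝ → ℝ)
    (hd1 : ∀ x ∈ O, HasDerivAt F (F' x) x)
    (hd2 : ∀ x ∈ O, HasDerivAt F' (F'' x) x)
    (hmono : StrictMonoOn F' O)
    (hbij : Set.BijOn F' O S)
    (G : ℝ → ℝ)
    (hGmaps : Set.MapsTo G S O)
    (hGF : ∀ x ∈ S, F' (G x) = x)
    (hFG : ∀ η ∈ O, G (F' η) = η)
    (ξ : ℝ → ℝ → ℝ)
    (hξ : ∀ k ν, ξ k ν =
      k * ((ν + 1 / k) * G (ν + 1 / k) - ν * G ν)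
        - k * (F (G (ν + 1 / k)) - F (G ν)))
    (ν : ℝ) (hν : ν ∈ S) :
    ∀ k₁ k₂ : ℝ, 0 < k₁ → k₁ < k₂ → ν + 1 / k₁ ∈ S →
      ξ k₂ ν < ξ k₁ ν := by
  have tang : ∀ a ∈ O, ∀ b ∈ O, a ≠ b → F' a * (b - a) < F b - F a := by
    intro a ha b hb hab
    rcases lt_or_gt_of_ne hab with h | h
    · have hs : Set.Icc a b ⊆ O := hOc.out ha hb
      obtain ⟨c, hc, hce⟩ := exists_hasDerivAt_eq_slope F F' h
        (fun x hx => (hd1 x (hs hx)).continuousAt.continuousWithinAt)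
        (fun x hx => hd1 x (hs ⟨hx.1.le, hx.2.le⟩))
      have h1 := hmono ha (hs ⟨hc.1.le, hc.2.le⟩) hc.1
      have h2 : 0 < b - a := sub_pos.2 h
      rw [eq_div_iff h2.ne'] at hce
      nlinarith
    · have hs : Set.Icc b a ⊆ O := hOc.out hb ha
      obtain ⟨c, hc, hce⟩ := exists_hasDerivAt_eq_slope F F' h
        (fun x hx => (hd1 x (hs hx)).continuousAt.continuousWithinAt)
        (fun x hx => hd1 x (hs ⟨hx.1.le, hx.2.le⟩))
      have h1 := hmono (hs ⟨hc.1.le, hc.2.le⟩) ha hc.2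
      have h2 : 0 < a - b := sub_pos.2 h
      rw [eq_div_iff h2.ne'] at hce
      nlinarith
  have dual : ∀ x ∈ S, ∀ y ∈ S, x ≠ y →
      G x * (y - x) < (y * G y - F (G y)) - (x * G x - F (G x)) := by
    intro x hx y hy hxy
    have hne : G y ≠ G x := fun h => hxy (by rw [← hGF x hx, ← hGF y hy, h])
    have h := tang (G y) (hGmaps hy) (G x) (hGmaps hx) hne
    rw [hGF y hy] at h
    linarith
  intro k₁ k₂ hk h12 hS
  have hk2 : 0 < k₂ := hk.trans h12
  have hp : 0 < 1 / k₂ := by positivity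
  have hlt : 1 / k₂ < 1 / k₁ := one_div_lt_one_div_of_lt hk h12
  have hm : ν + 1 / k₂ ∈ S := hSc.out hν hS ⟨by linarith, by linarith⟩
  have e1 : k₁ * (1 / k₁) = 1 := by field_simp
  have e2 : k₂ * (1 / k₂) = 1 := by field_simp
  rw [hξ, hξ]
  have A := dual _ hm _ hS (by linarith)
  have B := dual _ hm _ hν (by linarith)
  generalize 1 / k₁ = u at *
  generalize 1 / k₂ = v at *
  have A' := mul_lt_mul_of_pos_left A hk
  have B' := mul_lt_mul_of_pos_left B (sub_pos.2 h12)
  have z : k₁ * (G (ν + v) * (ν + u - (ν + v))) + (k₂ - k₁) * (G (ν + v) * (ν - (ν + v))) = 0 := by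
    linear_combination G (ν + v) * (e1 - e2)
  linarith
end

section
/- Let O and S be open intervals of ℝ and let F : ℝ → ℝ be twice differentiable on O with derivative F' strictly increasing on O and mapping O bijectively onto S; let G : S → O be the inverse of F' on O. Then for every ν ∈ S, ξ(k; ν) converges to G(ν) as k → ∞ (note that since S is open and ν ∈ S, the quantity ξ(k; ν) is defined for all sufficiently large k). -/
theorem tangent_le_aux (O : Set ℝ) (hOc : O.OrdConnected) (F F' : ℝ → ℝ)
    (hd1 : ∀ x ∈ O, HasDerivAt F (F' x) x) (hmono : StrictMonoOn F' O)
    (x y : ℝ) (hx : x ∈ O) (hy : y ∈ O) : F' x * (y - x) ≤ F y - F x := by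
  rcases lt_trichotomy x y with h | h | h
  · have hsub := hOc.out hx hy
    obtain ⟨c, hc, he⟩ := exists_hasDerivAt_eq_slope F F' h
      (fun z hz => (hd1 z (hsub hz)).continuousAt.continuousWithinAt)
      (fun z hz => hd1 z (hsub (Set.Ioo_subset_Icc_self hz)))
    have h1 := hmono hx (hsub (Set.Ioo_subset_Icc_self hc)) hc.1
    have h2 : 0 < y - x := sub_pos.2 h
    rw [he, lt_div_iff₀ h2] at h1
    exact h1.le
  · simp [h]
  · have hsub := hOc.out hy hx
    obtain ⟨c, hc, he⟩ := exists_hasDerivAt_eq_slope F F' h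
      (fun z hz => (hd1 z (hsub hz)).continuousAt.continuousWithinAt)
      (fun z hz => hd1 z (hsub (Set.Ioo_subset_Icc_self hz)))
    have h1 := hmono (hsub (Set.Ioo_subset_Icc_self hc)) hx hc.2
    have h2 : 0 < x - y := sub_pos.2 h
    rw [he, div_lt_iff₀ h2] at h1
    linarith

/-- `ξ(k; ν) → G(ν)` as `k → ∞`. -/
theorem rbmle_xi_tendsto_G
    (O S : Set ℝ) (hO : IsOpen O) (hOc : O.OrdConnected)
    (hSo : IsOpen S) (hSc : S.OrdConnected)
    (F F' F'' : ℝ → ℝ)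
    (hd1 : ∀ x ∈ O, HasDerivAt F (F' x) x)
    (hd2 : ∀ x ∈ O, HasDerivAt F' (F'' x) x)
    (hmono : StrictMonoOn F' O)
    (hbij : Set.BijOn F' O S)
    (G : ℝ → ℝ)
    (hGmaps : Set.MapsTo G S O)
    (hGF : ∀ x ∈ S, F' (G x) = x)
    (hFG : ∀ η ∈ O, G (F' η) = η)
    (ξ : ℝ → ℝ → ℝ)
    (hξ : ∀ k ν, ξ k ν =
      k * ((ν + 1 / k) * G (ν + 1 / k) - ν * G ν)
        - k * (F (G (ν + 1 / k)) - F (G ν)))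
    (ν : ℝ) (hν : ν ∈ S) :
    Filter.Tendsto (fun k => ξ k ν) Filter.atTop (nhds (G ν)) := by
  have hGmono : StrictMonoOn G S := by
    intro a ha b hb hab
    by_contra hcon
    have h1 := hmono.monotoneOn (hGmaps hb) (hGmaps ha) (not_lt.1 hcon)
    rw [hGF a ha, hGF b hb] at h1
    linarith
  have himg : Set.image G S ∈ nhds (G ν) := by
    refine Filter.mem_of_superset (hO.mem_nhds (hGmaps hν)) ?_
    intro η hη
    exact ⟨F' η, hbij.mapsTo hη, hFG η hη⟩
  have hcont : ContinuousAt G ν :=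
    hGmono.continuousAt_of_image_mem_nhds (hSo.mem_nhds hν) himg
  have hlim : Filter.Tendsto (fun k : ℝ => ν + 1 / k) Filter.atTop (nhds ν) := by
    have h := (tendsto_inv_atTop_zero (𝕜 := ℝ)).const_add ν
    simpa using h
  have hS : ∀ᶠ k : ℝ in Filter.atTop, ν + 1 / k ∈ S := hlim (hSo.mem_nhds hν)
  refine tendsto_of_tendsto_of_tendsto_of_le_of_le' tendsto_const_nhds (hcont.tendsto.comp hlim)
    ?_ ?_
  · filter_upwards [hS, Filter.eventually_gt_atTop 0] with k hk hk0
    have h := tangent_le_aux O hOc F F' hd1 hmono _ _ (hGmaps hk) (hGmaps hν)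
    rw [hGF _ hk] at h
    have h2 := mul_le_mul_of_nonneg_left h hk0.le
    have h3 : k * (1 / k) = 1 := by field_simp
    rw [hξ]
    linear_combination h2 - G ν * h3
  · filter_upwards [hS, Filter.eventually_gt_atTop 0] with k hk hk0
    have h := tangent_le_aux O hOc F F' hd1 hmono _ _ (hGmaps hν) (hGmaps hk)
    rw [hGF _ hν] at h
    have h2 := mul_le_mul_of_nonneg_left h hk0.le
    have h3 : k * (1 / k) = 1 := by field_simp
    rw [hξ]
    simp only [Function.comp]
    linear_combination h2 + G (ν + 1 / k) * h3
end

section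
/- Let O and S be open intervals of ℝ and let F : ℝ → ℝ be twice differentiable on O with derivative F' strictly increasing on O and mapping O bijectively onto S; let G : S → O be the inverse of F' on O. Then for every ν ∈ S and every k > 0 with ν + 1/k ∈ S, one has ξ(k; ν) > G(ν). Equivalently, for every ν ∈ S, n > 0 and α > 0 with ν + α/n ∈ S, the RBMLE index satisfies I(ν, n, α) > α·G(ν). -/
/-- `ξ(k; ν) > G(ν)` for all admissible `k > 0`; equivalently, the
RBMLE index satisfies `I(ν, n, α) > α·G(ν)`. -/
theorem rbmle_xi_gt_G_and_index_gt
    (O S : Set ℝ) (hO : IsOpen O) (hOc : O.OrdConnected)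
    (hSo : IsOpen S) (hSc : S.OrdConnected)
    (F F' F'' : ℝ → ℝ)
    (hd1 : ∀ x ∈ O, HasDerivAt F (F' x) x)
    (hd2 : ∀ x ∈ O, HasDerivAt F' (F'' x) x)
    (hmono : StrictMonoOn F' O)
    (hbij : Set.BijOn F' O S)
    (G : ℝ → ℝ)
    (hGmaps : Set.MapsTo G S O)
    (hGF : ∀ x ∈ S, F' (G x) = x)
    (hFG : ∀ η ∈ O, G (F' η) = η)
    (I : ℝ → ℝ → ℝ → ℝ)
    (hI : ∀ ν n α, I ν n α =
      (n * ν + α) * G (ν + α / n) - n * ν * G ν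
        - n * F (G (ν + α / n)) + n * F (G ν))
    (ξ : ℝ → ℝ → ℝ)
    (hξ : ∀ k ν, ξ k ν =
      k * ((ν + 1 / k) * G (ν + 1 / k) - ν * G ν)
        - k * (F (G (ν + 1 / k)) - F (G ν))) :
    (∀ ν ∈ S, ∀ k : ℝ, 0 < k → ν + 1 / k ∈ S → G ν < ξ k ν) ∧
    (∀ ν ∈ S, ∀ n α : ℝ, 0 < n → 0 < α → ν + α / n ∈ S →
      α * G ν < I ν n α) := by
  have key : ∀ ν ∈ S, ∀ μ ∈ S, ν < μ → F (G μ) - F (G ν) < μ * (G μ - G ν) := by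
    intro ν hν μ hμ hlt
    have ha := hGmaps hν
    have hb := hGmaps hμ
    have hab : G ν < G μ := by
      rw [← hmono.lt_iff_lt ha hb, hGF ν hν, hGF μ hμ]
      exact hlt
    have hsub : Set.Icc (G ν) (G μ) ⊆ O := hOc.out ha hb
    obtain ⟨c, hc, hce⟩ := exists_hasDerivAt_eq_slope F F' hab
      (fun x hx => (hd1 x (hsub hx)).continuousAt.continuousWithinAt)
      (fun x hx => hd1 x (hsub (Set.Ioo_subset_Icc_self hx)))
    have hcl : F' c < μ := by
      have h := hmono (hsub (Set.Ioo_subset_Icc_self hc)) hb hc.2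
      rwa [hGF μ hμ] at h
    have hpos : 0 < G μ - G ν := sub_pos.mpr hab
    rw [hce, div_lt_iff₀ hpos] at hcl
    exact hcl
  have main : ∀ ν ∈ S, ∀ n α : ℝ, 0 < n → 0 < α → ν + α / n ∈ S →
      α * G ν < I ν n α := by
    intro ν hν n α hn hα hμ
    have h := key ν hν _ hμ (lt_add_of_pos_right ν (div_pos hα hn))
    have h2 := mul_lt_mul_of_pos_left h hn
    have h3 : n * (ν + α / n) = n * ν + α := by field_simp
    rw [← mul_assoc, h3] at h2
    rw [hI]
    linarith
  refine ⟨?_, main⟩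
  intro ν hν k hk hμ
  have h := main ν hν k 1 hk one_pos hμ
  have h3 : k * (ν + 1 / k) = k * ν + 1 := by field_simp
  rw [hI, ← h3] at h
  rw [hξ]
  linarith
end

section
/- Let O and S be open intervals of ℝ and let F : ℝ → ℝ be twice differentiable on O with derivative F' strictly increasing on O and mapping O bijectively onto S; let G : S → O be the inverse of F' on O. If μ₁, μ₂ ∈ S with μ₁ > μ₂, then the set {k > 0 : μ₂ + 1/k ∈ S and G(μ₁) > ξ(k; μ₂)} is nonempty; consequently K*(μ₁, μ₂), defined as the infimum of this set, is a finite nonnegative real number. -/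
/-- When `μ₁ > μ₂`, the set defining `K*(μ₁, μ₂)` is nonempty, so
its infimum `K*(μ₁, μ₂)` is a finite nonnegative real number. -/
theorem rbmle_Kstar_finite
    (O S : Set ℝ) (hO : IsOpen O) (hOc : O.OrdConnected)
    (hSo : IsOpen S) (hSc : S.OrdConnected)
    (F F' F'' : ℝ → ℝ)
    (hd1 : ∀ x ∈ O, HasDerivAt F (F' x) x)
    (hd2 : ∀ x ∈ O, HasDerivAt F' (F'' x) x)
    (hmono : StrictMonoOn F' O)
    (hbij : Set.BijOn F' O S)
    (G : ℝ → ℝ)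
    (hGmaps : Set.MapsTo G S O)
    (hGF : ∀ x ∈ S, F' (G x) = x)
    (hFG : ∀ η ∈ O, G (F' η) = η)
    (ξ : ℝ → ℝ → ℝ)
    (hξ : ∀ k ν, ξ k ν =
      k * ((ν + 1 / k) * G (ν + 1 / k) - ν * G ν)
        - k * (F (G (ν + 1 / k)) - F (G ν)))
    (μ₁ μ₂ : ℝ) (hμ₁ : μ₁ ∈ S) (hμ₂ : μ₂ ∈ S) (hgt : μ₂ < μ₁) :
    {k : ℝ | 0 < k ∧ μ₂ + 1 / k ∈ S ∧ G μ₁ > ξ k μ₂}.Nonempty ∧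
    0 ≤ sInf {k : ℝ | 0 < k ∧ μ₂ + 1 / k ∈ S ∧ G μ₁ > ξ k μ₂} := by
  refine ⟨⟨1 / (μ₁ - μ₂), ?_⟩, Real.sInf_nonneg fun k hk => hk.1.le⟩
  have hpos : 0 < μ₁ - μ₂ := sub_pos.mpr hgt
  have hk : μ₂ + 1 / (1 / (μ₁ - μ₂)) = μ₁ := by rw [one_div_one_div]; ring
  have ha := hGmaps hμ₂
  have hb := hGmaps hμ₁
  have hab : G μ₂ < G μ₁ := by
    rw [← hmono.lt_iff_lt ha hb, hGF _ hμ₂, hGF _ hμ₁]; exact hgt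
  have hsub : Set.Icc (G μ₂) (G μ₁) ⊆ O := hOc.out ha hb
  obtain ⟨c, hc, hceq⟩ := exists_hasDerivAt_eq_slope F F' hab
    (fun x hx => (hd1 x (hsub hx)).continuousAt.continuousWithinAt)
    (fun x hx => hd1 x (hsub (Set.Ioo_subset_Icc_self hx)))
  have hlt : μ₂ < F' c := by
    have h := hmono ha (hsub (Set.Ioo_subset_Icc_self hc)) hc.1
    rwa [hGF _ hμ₂] at h
  rw [hceq, lt_div_iff₀ (sub_pos.mpr hab)] at hlt
  refine ⟨one_div_pos.mpr hpos, by rw [hk]; exact hμ₁, ?_⟩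
  rw [hξ, hk, ← mul_sub, gt_iff_lt, one_div_mul_eq_div, div_lt_iff₀ hpos]
  nlinarith
end

section
/- Let O and S be open intervals of ℝ and let F : ℝ → ℝ be twice differentiable on O with derivative F' strictly increasing on O and mapping O bijectively onto S; let G : S → O be the inverse of F' on O. Let μ₁, μ₂ ∈ S with μ₁ > μ₂ and let α > 0. Then for every n₁ > 0 with μ₁ + α/n₁ ∈ S and every n₂ > K*(μ₁, μ₂)·α, one has μ₂ + α/n₂ ∈ S (so I(μ₂, n₂, α) is well defined) and I(μ₁, n₁, α) > I(μ₂, n₂, α). -/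
/-- Strict tangent-line inequality. -/
theorem rbmle_tangent (O : Set ℝ) (hOc : O.OrdConnected) (F F' : ℝ → ℝ)
    (hd1 : ∀ x ∈ O, HasDerivAt F (F' x) x) (hmono : StrictMonoOn F' O)
    (a b : ℝ) (ha : a ∈ O) (hb : b ∈ O) (hab : a ≠ b) :
    F a + F' a * (b - a) < F b := by
  rcases lt_or_gt_of_ne hab with h | h
  · obtain ⟨c, hc, hc'⟩ := exists_hasDerivAt_eq_slope F F' h
      (fun x hx => (hd1 x (hOc.out ha hb hx)).continuousAt.continuousWithinAt)
      (fun x hx => hd1 x (hOc.out ha hb ⟨hx.1.le, hx.2.le⟩))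
    have h1 := hmono ha (hOc.out ha hb ⟨hc.1.le, hc.2.le⟩) hc.1
    rw [eq_div_iff (by linarith)] at hc'
    nlinarith
  · obtain ⟨c, hc, hc'⟩ := exists_hasDerivAt_eq_slope F F' h
      (fun x hx => (hd1 x (hOc.out hb ha hx)).continuousAt.continuousWithinAt)
      (fun x hx => hd1 x (hOc.out hb ha ⟨hx.1.le, hx.2.le⟩))
    have h1 := hmono (hOc.out hb ha ⟨hc.1.le, hc.2.le⟩) ha hc.2
    rw [eq_div_iff (by linarith)] at hc'
    nlinarith

/-- Lemma 3: If `μ₁ > μ₂`, then for any `n₁ > 0` (with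
`μ₁ + α/n₁ ∈ S`) and any `n₂ > K*(μ₁, μ₂)·α`, we have `μ₂ + α/n₂ ∈ S` and
`I(μ₁, n₁, α) > I(μ₂, n₂, α)`. -/
theorem rbmle_index_compare_after_enough_exploration
    (O S : Set ℝ) (hO : IsOpen O) (hOc : O.OrdConnected)
    (hSo : IsOpen S) (hSc : S.OrdConnected)
    (F F' F'' : ℝ → ℝ)
    (hd1 : ∀ x ∈ O, HasDerivAt F (F' x) x)
    (hd2 : ∀ x ∈ O, HasDerivAt F' (F'' x) x)
    (hmono : StrictMonoOn F' O)
    (hbij : Set.BijOn F' O S)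
    (G : ℝ → ℝ)
    (hGmaps : Set.MapsTo G S O)
    (hGF : ∀ x ∈ S, F' (G x) = x)
    (hFG : ∀ η ∈ O, G (F' η) = η)
    (I : ℝ → ℝ → ℝ → ℝ)
    (hI : ∀ ν n α, I ν n α =
      (n * ν + α) * G (ν + α / n) - n * ν * G ν
        - n * F (G (ν + α / n)) + n * F (G ν))
    (ξ : ℝ → ℝ → ℝ)
    (hξ : ∀ k ν, ξ k ν =
      k * ((ν + 1 / k) * G (ν + 1 / k) - ν * G ν)
        - k * (F (G (ν + 1 / k)) - F (G ν)))
    (Kstar : ℝ → ℝ → ℝ)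
    (hK : ∀ θ' θ'', Kstar θ' θ'' =
      sInf {k : ℝ | 0 < k ∧ θ'' + 1 / k ∈ S ∧ G θ' > ξ k θ''})
    (μ₁ μ₂ : ℝ) (hμ₁ : μ₁ ∈ S) (hμ₂ : μ₂ ∈ S) (hgt : μ₂ < μ₁)
    (α : ℝ) (hα : 0 < α) :
    ∀ n₁ n₂ : ℝ, 0 < n₁ → μ₁ + α / n₁ ∈ S → Kstar μ₁ μ₂ * α < n₂ →
      μ₂ + α / n₂ ∈ S ∧ I μ₂ n₂ α < I μ₁ n₁ α := by
  obtain ⟨H, hH⟩ : ∃ H : ℝ → ℝ, ∀ x, H x = x * G x - F (G x) := ⟨_, fun _ => rfl⟩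
  have hsub : ∀ x ∈ S, ∀ y ∈ S, x ≠ y → H x + (y - x) * G x < H y := by
    intro x hx y hy hxy
    have hne : G y ≠ G x := by
      intro h
      apply hxy
      rw [← hGF x hx, ← hGF y hy, h]
    have := rbmle_tangent O hOc F F' hd1 hmono (G y) (G x) (hGmaps hy) (hGmaps hx) hne
    rw [hGF y hy] at this
    rw [hH, hH]
    nlinarith
  have hξH : ∀ k ν, ξ k ν = k * (H (ν + 1 / k) - H ν) := by
    intro k ν
    rw [hξ, hH, hH]
    ring
  have hIH : ∀ ν n, 0 < n → I ν n α = n * (H (ν + α / n) - H ν) := by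
    intro ν n hn
    have e : n * ν + α = n * (ν + α / n) := by field_simp
    rw [hI, hH, hH, e]
    ring
  intro n₁ n₂ hn₁ hS₁ hn₂
  rw [hK] at hn₂
  have hne : {k : ℝ | 0 < k ∧ μ₂ + 1 / k ∈ S ∧ G μ₁ > ξ k μ₂}.Nonempty := by
    have hd : 0 < μ₁ - μ₂ := by linarith
    refine ⟨1 / (μ₁ - μ₂), by positivity, ?_, ?_⟩
    · simpa using hμ₁
    · rw [hξH, one_div_one_div, add_sub_cancel, one_div_mul_eq_div, gt_iff_lt, div_lt_iff₀ hd]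
      have := hsub μ₁ hμ₁ μ₂ hμ₂ hgt.ne'
      linarith
  rw [← lt_div_iff₀ hα] at hn₂
  obtain ⟨k', ⟨hk0, hkS, hkG⟩, hlt⟩ := exists_lt_of_csInf_lt hne hn₂
  have hk : 0 < n₂ / α := hk0.trans hlt
  have hn2 : 0 < n₂ := by
    have := mul_pos hk hα
    rwa [div_mul_cancel₀ _ hα.ne'] at this
  have hq : 0 < α / n₂ := by positivity
  have hqlt : α / n₂ < 1 / k' := by
    rw [lt_div_iff₀ hα] at hlt
    rw [div_lt_div_iff₀ hn2 hk0]
    linarith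
  have hzS : μ₂ + α / n₂ ∈ S := hSc.out hμ₂ hkS ⟨by linarith, by linarith⟩
  refine ⟨hzS, ?_⟩
  rw [hIH _ _ hn2, hIH _ _ hn₁]
  have hq1 : 0 < α / n₁ := by positivity
  have h1 := hsub μ₁ hμ₁ _ hS₁ (ne_of_lt (by linarith))
  have h1' : α * G μ₁ < n₁ * (H (μ₁ + α / n₁) - H μ₁) := by
    have h := mul_lt_mul_of_pos_left h1 hn₁
    have e : n₁ * (H μ₁ + (μ₁ + α / n₁ - μ₁) * G μ₁) = n₁ * H μ₁ + α * G μ₁ := by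
      field_simp
      ring
    rw [e] at h
    linarith
  have h2 := hsub _ hzS _ hμ₂ (ne_of_gt (by linarith))
  have h3 := hsub _ hzS _ hkS (ne_of_lt (by linarith))
  rw [hξH] at hkG
  have hw : H (μ₂ + 1 / k') - H μ₂ < G μ₁ * (1 / k') := by
    rw [mul_one_div, lt_div_iff₀ hk0]
    linarith
  generalize H (μ₂ + 1 / k') = A at *
  have hkp : 0 < 1 / k' := by positivity
  generalize 1 / k' = p at *
  have hnq : n₂ * (α / n₂) = α := by field_simp
  generalize α / n₂ = q at *
  generalize H (μ₂ + q) = B at *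
  generalize G (μ₂ + q) = g at *
  have h4 : p * (B - H μ₂) < p * (q * G μ₁) := by
    have a1 := mul_lt_mul_of_pos_left h2 (sub_pos.2 hqlt)
    have a2 := mul_lt_mul_of_pos_left h3 hq
    have a3 := mul_lt_mul_of_pos_left hw hq
    linarith
  have h5 := mul_lt_mul_of_pos_left (lt_of_mul_lt_mul_left h4 hkp.le) hn2
  rw [← mul_assoc, hnq] at h5
  linarith
end

section
/- Let O and S be open intervals of ℝ and let F : ℝ → ℝ be twice differentiable on O with derivative F' strictly increasing on O and mapping O bijectively onto S; let G : S → O be the inverse of F' on O. Let μ₀, μ₁, μ₂ ∈ S with μ₀ > μ₁ and μ₀ > μ₂, and let α > 0. Then for every n₁ with 0 < n₁ ≤ K*(μ₀, μ₁)·α and μ₁ + α/n₁ ∈ S, and every n₂ > K*(μ₀, μ₂)·α, one has I(μ₁, n₁, α) > I(μ₂, n₂, α). -/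
/-- Lemma 4: If `μ₀ > μ₁` and `μ₀ > μ₂`, then for any `n₁` with
`0 < n₁ ≤ K*(μ₀, μ₁)·α` (and `μ₁ + α/n₁ ∈ S`) and any `n₂ > K*(μ₀, μ₂)·α`, we
have `I(μ₁, n₁, α) > I(μ₂, n₂, α)`. -/
theorem rbmle_index_compare_under_exploration
    (O S : Set ℝ) (hO : IsOpen O) (hOc : O.OrdConnected)
    (hSo : IsOpen S) (hSc : S.OrdConnected)
    (F F' F'' : ℝ → ℝ)
    (hd1 : ∀ x ∈ O, HasDerivAt F (F' x) x)
    (hd2 : ∀ x ∈ O, HasDerivAt F' (F'' x) x)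
    (hmono : StrictMonoOn F' O)
    (hbij : Set.BijOn F' O S)
    (G : ℝ → ℝ)
    (hGmaps : Set.MapsTo G S O)
    (hGF : ∀ x ∈ S, F' (G x) = x)
    (hFG : ∀ η ∈ O, G (F' η) = η)
    (I : ℝ → ℝ → ℝ → ℝ)
    (hI : ∀ ν n α, I ν n α =
      (n * ν + α) * G (ν + α / n) - n * ν * G ν
        - n * F (G (ν + α / n)) + n * F (G ν))
    (ξ : ℝ → ℝ → ℝ)
    (hξ : ∀ k ν, ξ k ν =
      k * ((ν + 1 / k) * G (ν + 1 / k) - ν * G ν)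
        - k * (F (G (ν + 1 / k)) - F (G ν)))
    (Kstar : ℝ → ℝ → ℝ)
    (hK : ∀ θ' θ'', Kstar θ' θ'' =
      sInf {k : ℝ | 0 < k ∧ θ'' + 1 / k ∈ S ∧ G θ' > ξ k θ''})
    (μ₀ μ₁ μ₂ : ℝ) (hμ₀ : μ₀ ∈ S) (hμ₁ : μ₁ ∈ S) (hμ₂ : μ₂ ∈ S)
    (h01 : μ₁ < μ₀) (h02 : μ₂ < μ₀)
    (α : ℝ) (hα : 0 < α) :
    ∀ n₁ n₂ : ℝ, 0 < n₁ → n₁ ≤ Kstar μ₀ μ₁ * α → μ₁ + α / n₁ ∈ S →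
      Kstar μ₀ μ₂ * α < n₂ →
      I μ₂ n₂ α < I μ₁ n₁ α := by
  intro n₁ n₂ hn₁ hn₁K hn₁S hn₂
  -- strict tangent inequality for F
  have hT : ∀ a ∈ O, ∀ b ∈ O, a ≠ b → F' b * (a - b) < F a - F b := by
    intro a ha b hb hab
    rcases lt_or_gt_of_ne hab with h | h
    · have hsub : Set.Icc a b ⊆ O := hOc.out ha hb
      obtain ⟨c, hc, hce⟩ := exists_hasDerivAt_eq_slope F F' h
        (fun x hx => (hd1 x (hsub hx)).continuousAt.continuousWithinAt)
        (fun x hx => hd1 x (hsub ⟨hx.1.le, hx.2.le⟩))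
      have h1 := hmono (hsub ⟨hc.1.le, hc.2.le⟩) hb hc.2
      rw [hce, div_lt_iff₀ (by linarith)] at h1
      linarith
    · have hsub : Set.Icc b a ⊆ O := hOc.out hb ha
      obtain ⟨c, hc, hce⟩ := exists_hasDerivAt_eq_slope F F' h
        (fun x hx => (hd1 x (hsub hx)).continuousAt.continuousWithinAt)
        (fun x hx => hd1 x (hsub ⟨hx.1.le, hx.2.le⟩))
      have h1 := hmono hb (hsub ⟨hc.1.le, hc.2.le⟩) hc.1
      rw [hce, lt_div_iff₀ (by linarith)] at h1
      linarith
  -- Legendre transform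
  obtain ⟨H, hH⟩ : ∃ H : ℝ → ℝ, ∀ x, H x = x * G x - F (G x) := ⟨_, fun _ => rfl⟩
  have hsg : ∀ x ∈ S, ∀ y ∈ S, x ≠ y → H x + (y - x) * G x < H y := by
    intro x hx y hy hxy
    have hne : G x ≠ G y := by
      intro h
      apply hxy
      rw [← hGF x hx, ← hGF y hy, h]
    have := hT (G x) (hGmaps hx) (G y) (hGmaps hy) hne
    rw [hGF y hy] at this
    rw [hH, hH]
    linarith
  have hsg' : ∀ x ∈ S, ∀ y ∈ S, H x + (y - x) * G x ≤ H y := by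
    intro x hx y hy
    by_cases h : x = y
    · subst h; simp
    · exact (hsg x hx y hy h).le
  have hconv : ConvexOn ℝ S H := by
    refine ⟨hSc.convex, ?_⟩
    intro x hx y hy a b ha hb hab
    have hz := hSc.convex hx hy ha hb hab
    simp only [smul_eq_mul] at hz ⊢
    have h1 := mul_le_mul_of_nonneg_left (hsg' _ hz x hx) ha
    have h2 := mul_le_mul_of_nonneg_left (hsg' _ hz y hy) hb
    generalize hzz : a * x + b * y = z at *
    have e : a * (H z + (x - z) * G z) + b * (H z + (y - z) * G z) = H z := by
      have hb' : b = 1 - a := by linarith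
      subst hb'
      linear_combination (G z) * hzz
    linarith
  have hcont : ContinuousOn H S := hconv.continuousOn hSo
  have hξH : ∀ k ν, 0 < k → ξ k ν = k * (H (ν + 1 / k) - H ν) := by
    intro k ν _
    rw [hξ, hH, hH]
    ring
  have hIξ : ∀ ν n, 0 < n → I ν n α = α * ξ (n / α) ν := by
    intro ν n hn
    rw [hI, hξ, one_div_div]
    field_simp
    ring
  -- monotonicity
  have hanti : ∀ ν ∈ S, ∀ k k' : ℝ, 0 < k' → k' < k → ν + 1 / k' ∈ S →
      ν + 1 / k ∈ S ∧ ξ k ν < ξ k' ν := by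
    intro ν hν k k' hk' hkk hS
    have hk : 0 < k := hk'.trans hkk
    have hlt : 1 / k < 1 / k' := one_div_lt_one_div_of_lt hk' hkk
    have hpos : 0 < 1 / k := by positivity
    have hm : ν + 1 / k ∈ S := hSc.out hν hS ⟨by linarith, by linarith⟩
    refine ⟨hm, ?_⟩
    have h1 := hsg _ hm _ hS (by linarith)
    have h2 := hsg _ hm _ hν (by linarith)
    rw [hξH k ν hk, hξH k' ν hk']
    have h1' := mul_lt_mul_of_pos_left h1 hk'
    have h2' := mul_lt_mul_of_pos_left h2 (sub_pos.2 hkk)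
    have e : k' * (H (ν + 1 / k) + (ν + 1 / k' - (ν + 1 / k)) * G (ν + 1 / k))
        + (k - k') * (H (ν + 1 / k) + (ν - (ν + 1 / k)) * G (ν + 1 / k))
        = k * H (ν + 1 / k) := by
      generalize G (ν + 1 / k) = g
      generalize H (ν + 1 / k) = h
      field_simp
      ring
    linarith
  have hbdd : ∀ θ, BddBelow {k : ℝ | 0 < k ∧ θ + 1 / k ∈ S ∧ G μ₀ > ξ k θ} :=
    fun θ => ⟨0, fun k hk => hk.1.le⟩
  -- upper bound for arm 2
  have hne : {k : ℝ | 0 < k ∧ μ₂ + 1 / k ∈ S ∧ G μ₀ > ξ k μ₂}.Nonempty := by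
    have hp : 0 < μ₀ - μ₂ := by linarith
    refine ⟨1 / (μ₀ - μ₂), by positivity, ?_, ?_⟩
    · rw [one_div_one_div]; simpa using hμ₀
    · rw [hξH _ _ (by positivity), one_div_one_div, add_sub_cancel]
      have := hsg μ₀ hμ₀ μ₂ hμ₂ h02.ne'
      rw [gt_iff_lt, one_div, inv_mul_lt_iff₀ hp]
      linarith
  have hK2 : 0 ≤ Kstar μ₀ μ₂ := by
    rw [hK]
    exact Real.sInf_nonneg (fun k hk => hk.1.le)
  have hn₂p : 0 < n₂ := lt_of_le_of_lt (by positivity) hn₂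
  have hA : ξ (n₂ / α) μ₂ < G μ₀ := by
    have : Kstar μ₀ μ₂ < n₂ / α := by rwa [lt_div_iff₀ hα]
    rw [hK] at this
    obtain ⟨k', ⟨hk', hS', hg⟩, hlt⟩ := exists_lt_of_csInf_lt hne this
    exact (hanti μ₂ hμ₂ _ _ hk' hlt hS').2.trans hg
  -- lower bound for arm 1
  have hB : G μ₀ ≤ ξ (n₁ / α) μ₁ := by
    by_contra hcon
    push Not at hcon
    have hkp : 0 < n₁ / α := by positivity
    have hle : n₁ / α ≤ Kstar μ₀ μ₁ := by rwa [div_le_iff₀ hα]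
    have hS1 : μ₁ + 1 / (n₁ / α) ∈ S := by rwa [one_div_div]
    generalize n₁ / α = k at *
    have hc0 : ContinuousAt (fun x : ℝ => μ₁ + 1 / x) k :=
      continuousAt_const.add (continuousAt_const.div continuousAt_id hkp.ne')
    have hc1 : ContinuousAt (fun x : ℝ => H (μ₁ + 1 / x)) k :=
      ContinuousAt.comp (f := fun x : ℝ => μ₁ + 1 / x) (g := H)
        (hcont.continuousAt (hSo.mem_nhds hS1)) hc0
    have hc2 : ContinuousAt (fun x : ℝ => x * (H (μ₁ + 1 / x) - H μ₁)) k :=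
      continuousAt_id.mul (hc1.sub continuousAt_const)
    rw [hξH _ _ hkp] at hcon
    have hev := (hc2.eventually_lt continuousAt_const hcon).and
      ((hc0.eventually_mem (hSo.mem_nhds hS1)).and (lt_mem_nhds hkp))
    obtain ⟨l, hl, hsub⟩ := exists_Ioc_subset_of_mem_nhds hev ⟨0, hkp⟩
    obtain ⟨m, hm1, hm2⟩ := exists_between hl
    obtain ⟨a1, a2, a3⟩ := hsub ⟨hm1, hm2.le⟩
    have : Kstar μ₀ μ₁ ≤ m := by
      rw [hK]
      refine csInf_le (hbdd μ₁) ⟨a3, a2, ?_⟩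
      rw [hξH _ _ a3]
      exact a1
    linarith
  rw [hIξ _ _ hn₁, hIξ _ _ hn₂p]
  exact mul_lt_mul_of_pos_left (hA.trans_le hB) hα
end

section
/- Let O and S be open intervals of ℝ and let F : ℝ → ℝ be twice differentiable on O with derivative F' strictly increasing on O and mapping O bijectively onto S; let G : S → O be the inverse of F' on O. Let θ₁, θ₁', θ₂, θ₂' ∈ S satisfy θ₁ > θ₂, θ₁ ≤ θ₁' and θ₂' ≤ θ₂. Then K*(θ₁', θ₂') ≤ K*(θ₁, θ₂); that is, K*(θ', θ'') is nonincreasing in its first argument and nondecreasing in its second argument. -/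
/-- `K*(θ', θ'')` is nonincreasing in its first argument and
nondecreasing in its second argument. -/
theorem rbmle_Kstar_monotone
    (O S : Set ℝ) (hO : IsOpen O) (hOc : O.OrdConnected)
    (hSo : IsOpen S) (hSc : S.OrdConnected)
    (F F' F'' : ℝ → ℝ)
    (hd1 : ∀ x ∈ O, HasDerivAt F (F' x) x)
    (hd2 : ∀ x ∈ O, HasDerivAt F' (F'' x) x)
    (hmono : StrictMonoOn F' O)
    (hbij : Set.BijOn F' O S)
    (G : ℝ → ℝ)
    (hGmaps : Set.MapsTo G S O)
    (hGF : ∀ x ∈ S, F' (G x) = x)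
    (hFG : ∀ η ∈ O, G (F' η) = η)
    (ξ : ℝ → ℝ → ℝ)
    (hξ : ∀ k ν, ξ k ν =
      k * ((ν + 1 / k) * G (ν + 1 / k) - ν * G ν)
        - k * (F (G (ν + 1 / k)) - F (G ν)))
    (Kstar : ℝ → ℝ → ℝ)
    (hK : ∀ θ' θ'', Kstar θ' θ'' =
      sInf {k : ℝ | 0 < k ∧ θ'' + 1 / k ∈ S ∧ G θ' > ξ k θ''})
    (θ₁ θ₁' θ₂ θ₂' : ℝ)
    (hθ₁ : θ₁ ∈ S) (hθ₁' : θ₁' ∈ S) (hθ₂ : θ₂ ∈ S) (hθ₂' : θ₂' ∈ S)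
    (h12 : θ₂ < θ₁) (h1 : θ₁ ≤ θ₁') (h2 : θ₂' ≤ θ₂) :
    Kstar θ₁' θ₂' ≤ Kstar θ₁ θ₂ := by
  -- strict tangent-line inequality for `F`
  have tang : ∀ a ∈ O, ∀ b ∈ O, a ≠ b → F b + F' b * (a - b) < F a := by
    intro a ha b hb hab
    rcases lt_or_gt_of_ne hab with h | h
    · have hsub : Set.Icc a b ⊆ O := hOc.out ha hb
      obtain ⟨c, hc, hc'⟩ := exists_hasDerivAt_eq_slope F F' h
        (fun x hx => (hd1 x (hsub hx)).continuousAt.continuousWithinAt)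
        (fun x hx => hd1 x (hsub (Set.Ioo_subset_Icc_self hx)))
      have hlt := hmono (hsub (Set.Ioo_subset_Icc_self hc)) hb hc.2
      rw [eq_div_iff (by linarith)] at hc'
      nlinarith
    · have hsub : Set.Icc b a ⊆ O := hOc.out hb ha
      obtain ⟨c, hc, hc'⟩ := exists_hasDerivAt_eq_slope F F' h
        (fun x hx => (hd1 x (hsub hx)).continuousAt.continuousWithinAt)
        (fun x hx => hd1 x (hsub (Set.Ioo_subset_Icc_self hx)))
      have hlt := hmono hb (hsub (Set.Ioo_subset_Icc_self hc)) hc.1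
      rw [eq_div_iff (by linarith)] at hc'
      nlinarith
  have Gmono : ∀ x ∈ S, ∀ y ∈ S, x ≤ y → G x ≤ G y := by
    intro x hx y hy hxy
    have := (hmono.le_iff_le (hGmaps hx) (hGmaps hy)).1 (by rw [hGF x hx, hGF y hy]; exact hxy)
    exact this
  obtain ⟨H, hH⟩ : ∃ H : ℝ → ℝ, ∀ x, H x = x * G x - F (G x) := ⟨_, fun _ => rfl⟩
  have sub' : ∀ x ∈ S, ∀ y ∈ S, x ≠ y → G x * (y - x) < H y - H x := by
    intro x hx y hy hxy
    have hne : G x ≠ G y := fun h => hxy (by rw [← hGF x hx, ← hGF y hy, h])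
    have := tang _ (hGmaps hx) _ (hGmaps hy) hne
    rw [hGF y hy] at this
    rw [hH, hH]
    nlinarith
  have sub : ∀ x ∈ S, ∀ y ∈ S, G x * (y - x) ≤ H y - H x := by
    intro x hx y hy
    by_cases h : x = y
    · subst h; simp
    · exact (sub' x hx y hy h).le
  have incr : ∀ x' ∈ S, ∀ x ∈ S, ∀ d, 0 < d → x' ≤ x → x' + d ∈ S → x + d ∈ S →
      H (x' + d) - H x' ≤ H (x + d) - H x := by
    intro x' hx' x hx d hd hle h1 h2
    rcases le_total x (x' + d) with h | h
    · have e1 := sub x hx x' hx'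
      have e2 := sub _ h1 _ h2
      have e3 := Gmono _ hx _ h1 h
      nlinarith
    · have e1 := sub _ h1 x' hx'
      have e2 := sub _ hx _ h2
      have e3 := Gmono _ h1 _ hx h
      nlinarith
  have hξ' : ∀ k ν, ξ k ν = k * (H (ν + 1 / k) - H ν) := by
    intro k ν
    rw [hξ, hH, hH]; ring
  rw [hK, hK]
  apply csInf_le_csInf
  · exact ⟨0, fun k hk => hk.1.le⟩
  · have hp : 0 < θ₁ - θ₂ := by linarith
    refine ⟨1 / (θ₁ - θ₂), by positivity, ?_, ?_⟩
    · simpa using hθ₁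
    · rw [hξ', one_div_one_div, add_sub_cancel, gt_iff_lt, one_div_mul_eq_div, div_lt_iff₀ hp]
      have := sub' θ₁ hθ₁ θ₂ hθ₂ h12.ne'
      nlinarith
  · rintro k ⟨hk, hkS, hkG⟩
    have hd : 0 < 1 / k := by positivity
    have hS' : θ₂' + 1 / k ∈ S := hSc.out hθ₂' hkS ⟨by linarith, by linarith⟩
    refine ⟨hk, hS', ?_⟩
    have e1 := incr _ hθ₂' _ hθ₂ _ hd h2 hS' hkS
    have e2 := Gmono _ hθ₁ _ hθ₁' h1
    have e3 := mul_le_mul_of_nonneg_left e1 hk.le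
    rw [hξ'] at hkG ⊢
    linarith
end

section
/- Let γ > 0 and μ₁, μ₂ ∈ ℝ with μ₁ > μ₂. Let t > 1, let c ≥ 32·γ/(μ₁ − μ₂), and set α := c·log t. Then for every n₂ ≥ (2/(μ₁ − μ₂))·α and every n₁ > 0: μ₁ − √(γ·log t / n₁) + α/(2·n₁) > μ₂ + √(γ·log t / n₂) + α/(2·n₂). -/
/-- Lemma 6: the Gaussian RBMLE index of the optimal arm at its
lower confidence value beats that of a suboptimal, well-explored arm at its
upper confidence value. -/
theorem rbmle_gaussian_index_comparison
    (γ μ₁ μ₂ t c α : ℝ) (hγ : 0 < γ) (hμ : μ₂ < μ₁) (ht : 1 < t)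
    (hc : 32 * γ / (μ₁ - μ₂) ≤ c) (hα : α = c * Real.log t) :
    ∀ n₂ : ℝ, (2 / (μ₁ - μ₂)) * α ≤ n₂ → ∀ n₁ : ℝ, 0 < n₁ →
      μ₂ + Real.sqrt (γ * Real.log t / n₂) + α / (2 * n₂)
        < μ₁ - Real.sqrt (γ * Real.log t / n₁) + α / (2 * n₁) := by
  intro n₂ hn₂ n₁ hn₁
  have hL : 0 < Real.log t := Real.log_pos ht
  obtain ⟨D, hD⟩ : ∃ D, D = μ₁ - μ₂ := ⟨_, rfl⟩
  rw [← hD] at hc hn₂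
  have hDpos : 0 < D := by linarith
  have h1 : 32 * γ ≤ c * D := (div_le_iff₀ hDpos).1 hc
  have h2 : 32 * (γ * Real.log t) ≤ α * D := by
    rw [hα]; nlinarith [mul_le_mul_of_nonneg_right h1 hL.le]
  have hg : 0 < γ * Real.log t := mul_pos hγ hL
  have hαpos : 0 < α := by
    by_contra h
    nlinarith
  have h3 : 2 * α ≤ n₂ * D := by
    rw [div_mul_eq_mul_div] at hn₂
    exact (div_le_iff₀ hDpos).1 hn₂
  have hn₂pos : 0 < n₂ := by
    by_contra h
    nlinarith
  have e1 : α / (2 * n₂) ≤ D / 4 := by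
    rw [div_le_iff₀ (by positivity)]; linarith
  have e2 : Real.sqrt (γ * Real.log t / n₂) ≤ D / 8 := by
    apply Real.sqrt_le_iff.2
    refine ⟨by positivity, ?_⟩
    rw [div_le_iff₀ hn₂pos]
    nlinarith [mul_le_mul_of_nonneg_right h3 hDpos.le]
  have e3 : Real.sqrt (γ * Real.log t / n₁) ≤ α / (2 * n₁) + D / 2 := by
    apply Real.sqrt_le_iff.2
    refine ⟨by positivity, ?_⟩
    have hx : 0 < α / n₁ := by positivity
    have e : α / (2 * n₁) = (α / n₁) / 2 := by field_simp
    have h4 : γ * Real.log t / n₁ ≤ (α / n₁) * D / 32 := by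
      have : (α / n₁) * D / 32 = (α * D / 32) / n₁ := by field_simp
      rw [this]
      gcongr
      linarith
    rw [e]
    nlinarith [mul_pos hx hDpos, sq_nonneg (α / n₁), sq_nonneg D]
  linarith
end

section
/- Let γ > 0, Δ > 0, and let N ≥ 1 be a natural number. Let μᵢ, μⱼ ∈ ℝ and set δ := μⱼ − μᵢ. Let t > 1, let c ≥ 32·γ·(N+2)/Δ, set M := 32·γ·(N+2)/Δ² and α := c·log t. Then for every nᵢ with 0 < nᵢ ≤ (1/8)·M·(Δ/max(δ, Δ))·log t and every nⱼ ≥ M·log t: μᵢ − √(γ·log t / nᵢ) + α/(2·nᵢ) > μⱼ + √(γ·log t / nⱼ) + α/(2·nⱼ). -/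
/-- Lemma 7: the gap-adaptive Gaussian RBMLE index of an
under-explored arm `i` beats that of a well-explored arm `j`, with no ordering
assumed between `μᵢ` and `μⱼ`. -/
theorem rbmle_gaussian_adaptive_index_comparison
    (γ Δ : ℝ) (N : ℕ) (hγ : 0 < γ) (hΔ : 0 < Δ) (hN : 1 ≤ N)
    (μi μj δ : ℝ) (hδ : δ = μj - μi)
    (t c M α : ℝ) (ht : 1 < t)
    (hc : 32 * γ * ((N : ℝ) + 2) / Δ ≤ c)
    (hM : M = 32 * γ * ((N : ℝ) + 2) / Δ ^ 2)
    (hα : α = c * Real.log t) :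
    ∀ ni : ℝ, 0 < ni → ni ≤ (1 / 8) * M * (Δ / max δ Δ) * Real.log t →
    ∀ nj : ℝ, M * Real.log t ≤ nj →
      μj + Real.sqrt (γ * Real.log t / nj) + α / (2 * nj)
        < μi - Real.sqrt (γ * Real.log t / ni) + α / (2 * ni) := by
  intro ni hni hni2 nj hnj
  have hL : 0 < Real.log t := Real.log_pos ht
  set L := Real.log t with hLdef
  have hN' : (1 : ℝ) ≤ N := by exact_mod_cast hN
  have hMpos : 0 < M := by rw [hM]; positivity
  have hMγ : 96 * γ ≤ M * Δ ^ 2 := by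
    rw [hM, div_mul_cancel₀ _ (by positivity)]; nlinarith
  have hcM : M * Δ ≤ c := by
    have : M * Δ = 32 * γ * ((N : ℝ) + 2) / Δ := by rw [hM]; field_simp
    linarith
  have hnj0 : 0 < nj := lt_of_lt_of_le (by positivity) hnj
  set D := max δ Δ with hD
  have hD1 : δ ≤ D := le_max_left _ _
  have hD2 : Δ ≤ D := le_max_right _ _
  have hD0 : 0 < D := lt_of_lt_of_le hΔ hD2
  have e1 : α / (2 * nj) = c / 2 * (L / nj) := by rw [hα]; field_simp
  have e2 : α / (2 * ni) = c / 2 * (L / ni) := by rw [hα]; field_simp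
  rw [e1, e2, mul_div_assoc, mul_div_assoc]
  have hx : 8 * D ≤ M * Δ * (L / ni) := by
    have h : 8 * D * ni ≤ M * Δ * L := by
      calc 8 * D * ni ≤ 8 * D * ((1 / 8) * M * (Δ / D) * L) := by gcongr
        _ = M * Δ * L := by field_simp
    rw [← mul_div_assoc, le_div_iff₀ hni]; exact h
  have hy : M * (L / nj) ≤ 1 := by
    rw [← mul_div_assoc, div_le_one hnj0]; exact hnj
  have hx0 : 0 < L / ni := by positivity
  have hy0 : 0 < L / nj := by positivity
  generalize L / ni = x at *
  generalize L / nj = y at *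
  have hMx : 8 ≤ M * x := by
    by_contra h
    push Not at h
    nlinarith
  have hyx : 8 * y ≤ x := by
    by_contra h
    push Not at h
    nlinarith
  obtain ⟨z, hz⟩ : ∃ z, z = M * Δ * x / 8 := ⟨_, rfl⟩
  have hzD : D ≤ z := by linarith
  have hz0 : 0 < z := by linarith
  have s1 : Real.sqrt (γ * x) ≤ z / 3 := by
    apply Real.sqrt_le_iff.mpr
    refine ⟨by positivity, ?_⟩
    have h1 : 96 * γ * x ≤ M * Δ ^ 2 * x := by gcongr
    have h2 : M * Δ ^ 2 * x = 8 * Δ * z := by rw [hz]; ring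
    have h3 : Δ * z ≤ z * z := by
      apply mul_le_mul_of_nonneg_right _ hz0.le
      linarith
    nlinarith
  have s2 : Real.sqrt (γ * y) ≤ z / 3 := by
    refine le_trans (Real.sqrt_le_sqrt ?_) s1
    apply mul_le_mul_of_nonneg_left _ hγ.le
    linarith
  have h4 : M * Δ * (x - y) ≤ c * (x - y) := by
    apply mul_le_mul_of_nonneg_right hcM
    linarith
  have h5 : M * Δ * (8 * y) ≤ M * Δ * x := by gcongr
  linarith
end

section
/- Let δ > 0, γ > 0, let c ≥ 32·γ/δ and set M := 2/δ. Then the quadratic function w(x) := (c/(2γ))·x² − x + δ − √(γ/(c·M)) − 1/(2·M) is strictly positive for every real x; equivalently, its discriminant 1 − (2c/γ)·(δ − √(γ/(c·M)) − 1/(2·M)) is negative (indeed at most −39). -/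
/-- the quadratic arising in the Gaussian RBMLE regret analysis is
strictly positive everywhere, its discriminant being at most `−39`. -/
theorem rbmle_gaussian_quadratic_positive
    (δ γ c M : ℝ) (hδ : 0 < δ) (hγ : 0 < γ)
    (hc : 32 * γ / δ ≤ c) (hM : M = 2 / δ) :
    (∀ x : ℝ,
      0 < (c / (2 * γ)) * x ^ 2 - x + δ - Real.sqrt (γ / (c * M)) - 1 / (2 * M)) ∧
    1 - (2 * c / γ) * (δ - Real.sqrt (γ / (c * M)) - 1 / (2 * M)) ≤ -39 := by
  have hc0 : 0 < c := lt_of_lt_of_le (by positivity) hc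
  have hc' : 32 * γ ≤ c * δ := by rwa [div_le_iff₀ hδ] at hc
  have h1 : 1 / (2 * M) = δ / 4 := by
    subst hM
    field_simp
    norm_num
  have h2 : Real.sqrt (γ / (c * M)) ≤ δ / 8 := by
    apply Real.sqrt_le_iff.mpr
    refine ⟨by positivity, ?_⟩
    have h3 : γ / (c * M) = γ * δ / (2 * c) := by
      subst hM
      field_simp
    rw [h3, div_le_iff₀ (by positivity)]
    nlinarith [mul_le_mul_of_nonneg_right hc' hδ.le]
  rw [h1]
  have ha : 16 / δ ≤ c / (2 * γ) := by
    rw [div_le_div_iff₀ hδ (by positivity)]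
    linarith
  have hb : 64 / δ ≤ 2 * c / γ := by
    rw [div_le_div_iff₀ hδ hγ]
    linarith
  have hK : 5 * δ / 8 ≤ δ - Real.sqrt (γ / (c * M)) - δ / 4 := by linarith
  constructor
  · intro x
    have e1 : 16 / δ * x ^ 2 ≤ c / (2 * γ) * x ^ 2 :=
      mul_le_mul_of_nonneg_right ha (sq_nonneg x)
    have e2 : 16 / δ * x ^ 2 - x + 5 * δ / 8
        = 16 / δ * (x - δ / 32) ^ 2 + 39 * δ / 64 := by
      field_simp
      ring
    have e3 : 0 ≤ 16 / δ * (x - δ / 32) ^ 2 := by positivity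
    linarith
  · have e1 : 64 / δ * (5 * δ / 8) ≤
        2 * c / γ * (δ - Real.sqrt (γ / (c * M)) - δ / 4) :=
      mul_le_mul hb hK (by positivity) (by positivity)
    have e2 : 64 / δ * (5 * δ / 8) = 40 := by
      field_simp
      norm_num
    linarith
end

section
/- Let N ≥ 1 be a natural number, let D be a nonempty subset of ℝ^N, let f : ℝ^N → ℝ and α > 0. Define Φ(η) := f(η) + α·max_{1≤i≤N} ηᵢ and, for each arm i, Vᵢ := sup_{η ∈ D} (f(η) + α·ηᵢ). Then: (a) sup_{η ∈ D} Φ(η) = max_{1≤i≤N} Vᵢ; and (b) if η̂ ∈ D satisfies Φ(η̂) ≥ Φ(η) for all η ∈ D, then every index i with η̂ᵢ = max_{1≤j≤N} η̂ⱼ satisfies Vᵢ = max_{1≤j≤N} Vⱼ. -/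
/-- indexability reduction for the RBMLE policy. The supremum of
the reward-biased log-likelihood `Φ` equals the maximum over arms of the
per-arm biased values `Vᵢ`, and any arm whose coordinate is maximal at a
maximizer `η̂` of `Φ` attains the maximal per-arm value. Suprema over the
(possibly unbounded) parameter set `D` are taken in the extended reals. -/
theorem rbmle_indexability
    (N : ℕ) (hN : 1 ≤ N) (D : Set (Fin N → ℝ)) (hD : D.Nonempty)
    (f : (Fin N → ℝ) → ℝ) (α : ℝ) (hα : 0 < α)
    (Φ : (Fin N → ℝ) → ℝ)
    (hΦ : ∀ η, Φ η = f η + α * ⨆ i : Fin N, η i)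
    (V : Fin N → EReal)
    (hV : ∀ i, V i = ⨆ η ∈ D, ((f η + α * η i : ℝ) : EReal)) :
    (⨆ η ∈ D, ((Φ η : ℝ) : EReal)) = (⨆ i : Fin N, V i) ∧
    (∀ ηhat ∈ D, (∀ η ∈ D, Φ η ≤ Φ ηhat) →
      ∀ i : Fin N, ηhat i = (⨆ j : Fin N, ηhat j) →
        V i = ⨆ j : Fin N, V j) := by
  haveI : Nonempty (Fin N) := ⟨⟨0, hN⟩⟩
  have key : ∀ η ∈ D, ∀ i, ((f η + α * η i : ℝ) : EReal) ≤ V i := by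
    intro η hη i
    rw [hV i]
    exact le_iSup₂ (f := fun η (_ : η ∈ D) => ((f η + α * η i : ℝ) : EReal)) η hη
  have hle : ∀ η i, f η + α * η i ≤ Φ η := by
    intro η i
    rw [hΦ η]
    have h : η i ≤ ⨆ j : Fin N, η j := le_ciSup (Set.finite_range η).bddAbove i
    have := mul_le_mul_of_nonneg_left h hα.le
    linarith
  have hVle : ∀ i, V i ≤ ⨆ η ∈ D, ((Φ η : ℝ) : EReal) := by
    intro i
    rw [hV i]
    exact iSup₂_mono fun η _ => EReal.coe_le_coe_iff.mpr (hle η i)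
  have ha : (⨆ η ∈ D, ((Φ η : ℝ) : EReal)) = (⨆ i : Fin N, V i) := by
    apply le_antisymm
    · refine iSup₂_le fun η hη => ?_
      obtain ⟨i, hi⟩ := exists_eq_ciSup_of_finite (f := η)
      rw [hΦ η, ← hi]
      exact (key η hη i).trans (le_iSup V i)
    · exact iSup_le hVle
  refine ⟨ha, fun ηhat hhat hmax i hi => le_antisymm (le_iSup V i) ?_⟩
  rw [← ha]
  refine iSup₂_le fun η hη => ?_
  refine (EReal.coe_le_coe_iff.mpr (hmax η hη)).trans ?_
  rw [hΦ ηhat, ← hi]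
  exact key ηhat hhat i
end
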